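/- Proposition Bottom: for 0 < q < 1 and s = q^{1/3}, the q-Legendre polynomial P_n(x) = Q_n(x; s, 1) satisfies (1/(1-q)) ∫_s^1 x^n P_n(x) d_q x = q^{n²} (q;q)_n² (q^{-n}s; q)_{2n+1} / ((q^{n+1};q)_n (q^{n+1};q)_{n+1}). -/

import Mathlib

/-- The q-derivative. -/
noncomputable def qDeriv (q : ℝ) (f : ℝ → ℝ) (x : ℝ) : ℝ :=
  (f x - f (q * x)) / ((1 - q) * x)

/-- The Jackson q-integral over `[0,a]`. -/
noncomputable def qInt0 (q a : ℝ) (f : ℝ → ℝ) : ℝ :=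
  a * (1 - q) * ∑' r : ℕ, f (a * q ^ r) * q ^ r

/-- The Jackson q-integral over `[c,d]`. -/
noncomputable def qInt (q c d : ℝ) (f : ℝ → ℝ) : ℝ :=
  qInt0 q d f - qInt0 q c f

/-- The q-Legendre polynomial over `[s,1]`:
`Pₙ(x) = ((1-q)ⁿ/(q^{n+1};q)ₙ) D_qⁿ [∏_{i<n} (x-qⁱ)(x-sqⁱ)]`. -/
noncomputable def qLegendreS1 (q s : ℝ) (n : ℕ) : ℝ → ℝ := fun x =>
  (1 - q) ^ n / (∏ i ∈ Finset.range n, (1 - q ^ (n + 1) * q ^ i)) *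
    (qDeriv q)^[n]
      (fun y => ∏ i ∈ Finset.range n, ((y - q ^ i) * (y - s * q ^ i))) x

open Polynomial in
/-- Scaling of the variable. -/
noncomputable def qShift (q : ℝ) (p : ℝ[X]) : ℝ[X] := p.comp (C q * X)

open Polynomial in
/-- Polynomial version of `(1-q)` times the q-derivative. -/
noncomputable def qE (q : ℝ) (p : ℝ[X]) : ℝ[X] := (p - qShift q p).divX

open Polynomial in
/-- Normalised Jackson integral of a polynomial. -/
noncomputable def qL (q s : ℝ) (p : ℝ[X]) : ℝ :=
  (∑' r : ℕ, p.eval (q ^ r) * q ^ r) - s * ∑' r : ℕ, p.eval (s * q ^ r) * q ^ r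

open Polynomial in
lemma qShift_eval (q : ℝ) (p : ℝ[X]) (x : ℝ) : (qShift q p).eval x = p.eval (q * x) := by
  simp [qShift]

open Polynomial in
lemma qE_mul_X (q : ℝ) (p : ℝ[X]) : qE q p * X = p - qShift q p := by
  have h := divX_mul_X_add (p - qShift q p)
  have h0 : (p - qShift q p).coeff 0 = 0 := by
    rw [coeff_zero_eq_eval_zero]; simp [qShift]
  rw [h0] at h
  simpa [qE] using h

open Polynomial in
lemma qE_eval (q : ℝ) (p : ℝ[X]) (x : ℝ) :
    (qE q p).eval x * x = p.eval x - p.eval (q * x) := by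
  have h := congrArg (eval x) (qE_mul_X q p)
  simpa [qShift_eval] using h

open Polynomial in
lemma qE_unique (q : ℝ) (p r : ℝ[X]) (h : r * X = p - qShift q p) : qE q p = r := by
  apply mul_right_cancel₀ (X_ne_zero (R := ℝ))
  rw [qE_mul_X, h]

open Polynomial in
lemma qE_mul (q : ℝ) (f g : ℝ[X]) : qE q (f * g) = f * qE q g + qShift q g * qE q f := by
  apply qE_unique
  have h1 := qE_mul_X q f
  have h2 := qE_mul_X q g
  have h3 : qShift q (f * g) = qShift q f * qShift q g := by simp [qShift]
  rw [h3]
  linear_combination f * h2 + qShift q g * h1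

open Polynomial in
lemma qE_X_pow (q : ℝ) (m : ℕ) : qE q (X ^ (m + 1)) = C (1 - q ^ (m + 1)) * X ^ m := by
  apply qE_unique
  simp [qShift, mul_pow]
  ring

open Polynomial in
lemma qsummable (q : ℝ) (hq : 0 < q) (hq1 : q < 1) (a : ℝ) (p : ℝ[X]) :
    Summable (fun r : ℕ => p.eval (a * q ^ r) * q ^ r) := by
  induction p using Polynomial.induction_on' with
  | add p r hp hr =>
    simpa [add_mul] using hp.add hr
  | monomial k c =>
    have h : Summable (fun r : ℕ => (c * a ^ k) * (q ^ (k + 1)) ^ r) := by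
      apply Summable.mul_left
      apply summable_geometric_of_lt_one (by positivity)
      exact pow_lt_one₀ hq.le hq1 (by omega)
    refine h.congr fun r => ?_
    simp only [eval_monomial]
    ring

open Polynomial in
lemma qL_add (q s : ℝ) (hq : 0 < q) (hq1 : q < 1) (p r : ℝ[X]) :
    qL q s (p + r) = qL q s p + qL q s r := by
  have a1 := qsummable q hq hq1 1 p
  have a2 := qsummable q hq hq1 1 r
  simp only [one_mul] at a1 a2
  simp only [qL, eval_add, add_mul]
  rw [a1.tsum_add a2, (qsummable q hq hq1 s p).tsum_add (qsummable q hq hq1 s r)]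
  ring

open Polynomial in
lemma qL_smul (q s c : ℝ) (p : ℝ[X]) :
    qL q s (C c * p) = c * qL q s p := by
  simp only [qL, eval_mul, eval_C, mul_assoc, tsum_mul_left]
  ring

open Polynomial in
lemma qFTC0 (q : ℝ) (hq : 0 < q) (hq1 : q < 1) (a : ℝ) (F : ℝ[X]) :
    a * ∑' r : ℕ, (qE q F).eval (a * q ^ r) * q ^ r = F.eval a - F.eval 0 := by
  have hs := (qsummable q hq hq1 a (qE q F)).mul_left a
  rw [← tsum_mul_left]
  have h1 := hs.hasSum.tendsto_sum_nat
  have h2 : ∀ n : ℕ, ∑ r ∈ Finset.range n, a * ((qE q F).eval (a * q ^ r) * q ^ r)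
      = F.eval a - F.eval (a * q ^ n) := by
    intro n
    induction n with
    | zero => simp
    | succ n ih =>
      rw [Finset.sum_range_succ, ih]
      have := qE_eval q F (a * q ^ n)
      have e : q * (a * q ^ n) = a * q ^ (n + 1) := by ring
      rw [e] at this
      linear_combination this
  simp only [h2] at h1
  refine tendsto_nhds_unique h1 ?_
  have h3 : Filter.Tendsto (fun n : ℕ => a * q ^ n) Filter.atTop (nhds 0) := by
    simpa using (tendsto_pow_atTop_nhds_zero_of_lt_one hq.le hq1).const_mul a
  exact ((F.continuous.tendsto 0).comp h3).const_sub _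

open Polynomial in
lemma qFTC (q s : ℝ) (hq : 0 < q) (hq1 : q < 1) (F : ℝ[X]) :
    qL q s (qE q F) = F.eval 1 - F.eval s := by
  have h1 := qFTC0 q hq hq1 1 F
  have h2 := qFTC0 q hq hq1 s F
  simp only [one_mul] at h1
  rw [qL, h1, h2]; ring

open Polynomial in
lemma qL_shift (q s : ℝ) (hq : 0 < q) (hq1 : q < 1) (F : ℝ[X])
    (h1 : F.eval 1 = 0) (hs : F.eval s = 0) :
    q * qL q s (qShift q F) = qL q s F := by
  have key : ∀ a : ℝ, F.eval a = 0 →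
      q * ∑' r : ℕ, (qShift q F).eval (a * q ^ r) * q ^ r
        = ∑' r : ℕ, F.eval (a * q ^ r) * q ^ r := by
    intro a ha
    rw [(qsummable q hq hq1 a F).tsum_eq_zero_add, ← tsum_mul_left]
    simp only [pow_zero, mul_one, ha, zero_add]
    refine tsum_congr fun r => ?_
    rw [qShift_eval]
    have e : q * (a * q ^ r) = a * q ^ (r + 1) := by ring
    rw [e]; ring
  have k1 := key 1 h1
  have k2 := key s hs
  simp only [one_mul] at k1
  rw [qL, qL, ← k1, ← k2]; ring

open Polynomial in
lemma qL_parts (q s : ℝ) (hq : 0 < q) (hq1 : q < 1) (f g : ℝ[X])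
    (h1 : f.eval 1 * g.eval 1 = 0) (hs : f.eval s * g.eval s = 0) :
    qL q s (f * qE q g) = - qL q s (qShift q g * qE q f) := by
  have h := qFTC q s hq hq1 (f * g)
  rw [qE_mul, qL_add q s hq hq1, eval_mul, eval_mul, h1, hs] at h
  linarith

open Polynomial in
lemma qL_step (q s : ℝ) (hq : 0 < q) (hq1 : q < 1) (m : ℕ) (g : ℝ[X])
    (h1 : g.eval 1 = 0) (hs : g.eval s = 0) :
    qL q s (X ^ (m + 1) * qE q g) =
      (-(1 - q ^ (m + 1)) / q ^ (m + 1)) * qL q s (X ^ m * g) := by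
  rw [qL_parts q s hq hq1 _ _ (by simp [h1]) (by simp [hs]), qE_X_pow]
  have h2 := qL_shift q s hq hq1 (X ^ m * g) (by simp [h1]) (by simp [hs])
  have h3 : qShift q (X ^ m * g) = C (q ^ m) * (X ^ m * qShift q g) := by
    simp [qShift, mul_pow]; ring
  rw [h3, qL_smul] at h2
  have h4 : qShift q g * (C (1 - q ^ (m + 1)) * X ^ m)
      = C (1 - q ^ (m + 1)) * (X ^ m * qShift q g) := by ring
  rw [h4, qL_smul, ← h2]
  field_simp
  ring

open Polynomial in
lemma qE_vanish (q : ℝ) (hq : 0 < q) (x : ℝ) (hx : x ≠ 0) (k : ℕ) : ∀ (m : ℕ) (p : ℝ[X]),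
    (∀ j < m + k, p.eval (x * q ^ j) = 0) → ∀ j < m, ((qE q)^[k] p).eval (x * q ^ j) = 0 := by
  induction k with
  | zero => intro m p h j hj; exact h j hj
  | succ k ih =>
    intro m p h j hj
    rw [Function.iterate_succ_apply]
    refine ih m (qE q p) ?_ j hj
    intro i hi
    have e := qE_eval q p (x * q ^ i)
    have e2 : q * (x * q ^ i) = x * q ^ (i + 1) := by ring
    rw [e2, h i (by omega), h (i + 1) (by omega), sub_zero] at e
    exact (mul_eq_zero.mp e).resolve_right (by positivity)

open Polynomial in
lemma qL_rodrigues (q s : ℝ) (hq : 0 < q) (hq1 : q < 1) (hs : s ≠ 0) (n : ℕ) (w : ℝ[X])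
    (h1 : ∀ j < n, w.eval (1 * q ^ j) = 0) (h2 : ∀ j < n, w.eval (s * q ^ j) = 0) :
    ∀ k ≤ n, qL q s (X ^ k * (qE q)^[k] w) =
      (∏ a ∈ Finset.range k, (-(1 - q ^ (a + 1)) / q ^ (a + 1))) * qL q s w := by
  intro k
  induction k with
  | zero => intro _; simp
  | succ k ih =>
    intro hk
    rw [Function.iterate_succ_apply', qL_step q s hq hq1, ih (by omega), Finset.prod_range_succ]
    · ring
    · have := qE_vanish q hq 1 one_ne_zero k 1 w (fun j hj => h1 j (by omega)) 0 (by omega)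
      simpa using this
    · have := qE_vanish q hq s hs k 1 w (fun j hj => h2 j (by omega)) 0 (by omega)
      simpa using this

open Polynomial in
/-- `∏_{i<a} (X - c qⁱ)`. -/
noncomputable def qA (q c : ℝ) (a : ℕ) : ℝ[X] := ∏ i ∈ Finset.range a, (X - C (c * q ^ i))

open Polynomial in
lemma qShift_qA (q c : ℝ) (hq : 0 < q) (a : ℕ) :
    qShift q (qA q c (a + 1)) = C (q ^ (a + 1)) * (X - C (c / q)) * qA q c a := by
  induction a with
  | zero =>
    simp only [qA, qShift, zero_add, Finset.prod_range_one, Finset.prod_range_zero, sub_comp,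
      X_comp, C_comp, pow_zero, mul_one, pow_one, mul_sub, ← C_mul]
    rw [mul_div_cancel₀ _ hq.ne']
  | succ a ih =>
    have e : qA q c (a + 1 + 1) = qA q c (a + 1) * (X - C (c * q ^ (a + 1))) := by
      simp [qA, Finset.prod_range_succ]
    have e1 : qA q c (a + 1) = qA q c a * (X - C (c * q ^ a)) := by
      simp [qA, Finset.prod_range_succ]
    have e2 : qShift q (qA q c (a + 1 + 1)) =
        qShift q (qA q c (a + 1)) * (C q * X - C (c * q ^ (a + 1))) := by
      rw [e]; simp [qShift]
    rw [e2, ih, e1]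
    simp only [pow_succ, C_mul]
    ring

open Polynomial in
lemma qE_qA (q c : ℝ) (hq : 0 < q) (a : ℕ) :
    qE q (qA q c (a + 1)) = C (1 - q ^ (a + 1)) * qA q c a := by
  apply qE_unique
  rw [qShift_qA q c hq]
  have e1 : qA q c (a + 1) = qA q c a * (X - C (c * q ^ a)) := by
    simp [qA, Finset.prod_range_succ]
  have e3 : C (q ^ (a + 1)) * C (c / q) = C (c * q ^ a) := by
    rw [← C_mul]; congr 1; field_simp; ring
  rw [e1, C_sub, C_1]
  linear_combination (-qA q c a) * e3

open Polynomial in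
lemma qA_eval_self (q c : ℝ) (a j : ℕ) (h : j < a) : (qA q c a).eval (c * q ^ j) = 0 := by
  rw [qA, eval_prod]
  exact Finset.prod_eq_zero (Finset.mem_range.mpr h) (by simp)

open Polynomial in
lemma qBeta_rec (q s : ℝ) (hq : 0 < q) (hq1 : q < 1) (a b : ℕ) :
    (1 - q ^ (b + 1 + (a + 1))) * qL q s (qA q 1 (a + 1) * qA q s b) =
      -(1 - q ^ (a + 1)) * q ^ b * (q ^ (a + 1) - s) * qL q s (qA q 1 a * qA q s b) := by
  have z1 : (qA q 1 (a + 1)).eval 1 = 0 := by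
    simpa using qA_eval_self q 1 (a + 1) 0 (by omega)
  have z2 : (qA q s (b + 1)).eval s = 0 := by
    simpa using qA_eval_self q s (b + 1) 0 (by omega)
  have h := qL_parts q s hq hq1 (qA q 1 (a + 1)) (qA q s (b + 1)) (by simp [z1]) (by simp [z2])
  rw [qE_qA q _ hq, qE_qA q _ hq, qShift_qA q _ hq] at h
  have e1 : qA q 1 (a + 1) = qA q 1 a * (X - C (q ^ a)) := by
    simp [qA, Finset.prod_range_succ]
  have e2 : C (q ^ (b + 1)) * (X - C (s / q)) * qA q s b * (C (1 - q ^ (a + 1)) * qA q 1 a)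
      = C (q ^ (b + 1) * (1 - q ^ (a + 1))) * (qA q 1 (a + 1) * qA q s b)
        + C (q ^ (b + 1) * (1 - q ^ (a + 1)) * (q ^ a - s / q)) * (qA q 1 a * qA q s b) := by
    rw [e1]; simp only [C_mul, C_sub]; ring
  have e3 : qA q 1 (a + 1) * (C (1 - q ^ (b + 1)) * qA q s b)
      = C (1 - q ^ (b + 1)) * (qA q 1 (a + 1) * qA q s b) := by ring
  rw [e2, e3, qL_add q s hq hq1, qL_smul, qL_smul, qL_smul] at h
  have e4 : q ^ (b + 1) * (1 - q ^ (a + 1)) * (q ^ a - s / q)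
      = q ^ b * (1 - q ^ (a + 1)) * (q ^ (a + 1) - s) := by
    field_simp; ring
  rw [e4] at h
  rw [pow_add q (b + 1) (a + 1)]
  linear_combination h

open Polynomial in
lemma qBeta (q s : ℝ) (hq : 0 < q) (hq1 : q < 1) (b a : ℕ) :
    qL q s (qA q 1 a * qA q s b) =
      (∏ i ∈ Finset.range a,
        (-(1 - q ^ (i + 1)) * q ^ b * (q ^ (i + 1) - s) / (1 - q ^ (b + 1 + (i + 1))))) *
      ((∏ i ∈ Finset.range (b + 1), (1 - s * q ^ i)) / (1 - q ^ (b + 1))) := by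
  have ne : ∀ m : ℕ, 1 - q ^ (m + 1) ≠ 0 := fun m =>
    (sub_pos.mpr (pow_lt_one₀ hq.le hq1 (by omega))).ne'
  induction a with
  | zero =>
    have h := qFTC q s hq hq1 (qA q s (b + 1))
    have z2 : (qA q s (b + 1)).eval s = 0 := by
      simpa using qA_eval_self q s (b + 1) 0 (by omega)
    rw [qE_qA q _ hq, qL_smul, z2] at h
    have z3 : (qA q s (b + 1)).eval 1 = ∏ i ∈ Finset.range (b + 1), (1 - s * q ^ i) := by
      rw [qA, eval_prod]; simp
    rw [z3] at h
    have z4 : qA q 1 0 = 1 := by simp [qA]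
    rw [z4, one_mul, Finset.prod_range_zero, one_mul, eq_div_iff (ne b)]
    linarith
  | succ a ih =>
    have h := qBeta_rec q s hq hq1 a b
    rw [ih] at h
    have hn := ne (b + 1 + a)
    rw [Finset.prod_range_succ]
    have : b + 1 + (a + 1) = b + 1 + a + 1 := by ring
    rw [this] at h ⊢
    apply mul_left_cancel₀ hn
    rw [h]
    field_simp

open Polynomial in
lemma qDeriv_iter (q : ℝ) (hq : 0 < q) (hq1 : q < 1) (p : ℝ[X]) (k : ℕ) :
    ∀ x : ℝ, x ≠ 0 → (1 - q) ^ k * (qDeriv q)^[k] (fun y => p.eval y) x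
      = ((qE q)^[k] p).eval x := by
  have h1q : 1 - q ≠ 0 := (sub_pos.mpr hq1).ne'
  induction k with
  | zero => intro x _; simp
  | succ k ih =>
    intro x hx
    rw [Function.iterate_succ_apply', Function.iterate_succ_apply']
    have e := qE_eval q ((qE q)^[k] p) x
    rw [← ih x hx, ← ih (q * x) (by positivity)] at e
    apply mul_right_cancel₀ hx
    rw [e, qDeriv]
    field_simp
    ring

/-- Proposition Bottom. -/
theorem proposition_bottom (q : ℝ) (hq : 0 < q) (hq1 : q < 1) (n : ℕ)
    (s : ℝ) (hs : s = q ^ ((1 : ℝ) / 3)) :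
    1 / (1 - q) * qInt q s 1 (fun x => x ^ n * qLegendreS1 q s n x) =
      q ^ (n ^ 2) * (∏ i ∈ Finset.range n, (1 - q ^ (i + 1))) ^ 2 *
        (∏ i ∈ Finset.range (2 * n + 1), (1 - q ^ (-(n : ℤ)) * s * q ^ i)) /
        ((∏ i ∈ Finset.range n, (1 - q ^ (n + 1) * q ^ i)) *
          (∏ i ∈ Finset.range (n + 1), (1 - q ^ (n + 1) * q ^ i))) := by
  have hs0 : 0 < s := by rw [hs]; positivity
  clear hs
  have h1q : 1 - q ≠ 0 := (sub_pos.mpr hq1).ne'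
  have ne : ∀ m : ℕ, 1 - q ^ (m + 1) ≠ 0 := fun m =>
    (sub_pos.mpr (pow_lt_one₀ hq.le hq1 (by omega))).ne'
  set w : Polynomial ℝ := qA q 1 n * qA q s n with hw
  set c : ℝ := ∏ i ∈ Finset.range n, (1 - q ^ (n + 1) * q ^ i) with hc
  have hwe : (fun y : ℝ => ∏ i ∈ Finset.range n, ((y - q ^ i) * (y - s * q ^ i)))
      = fun y => w.eval y := by
    funext y
    rw [hw, Polynomial.eval_mul, qA, qA, Polynomial.eval_prod, Polynomial.eval_prod,
      ← Finset.prod_mul_distrib]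
    simp
  have hP : ∀ x : ℝ, x ≠ 0 → x ^ n * qLegendreS1 q s n x
      = c⁻¹ * (Polynomial.X ^ n * (qE q)^[n] w).eval x := by
    intro x hx
    have := qDeriv_iter q hq hq1 w n x hx
    rw [qLegendreS1, hwe, Polynomial.eval_mul, ← this]
    simp only [Polynomial.eval_pow, Polynomial.eval_X]
    rw [← hc]
    ring
  have hL : 1 / (1 - q) * qInt q s 1 (fun x => x ^ n * qLegendreS1 q s n x)
      = c⁻¹ * qL q s (Polynomial.X ^ n * (qE q)^[n] w) := by
    have k : ∀ a : ℝ, a ≠ 0 →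
        ∑' r : ℕ, ((a * q ^ r) ^ n * qLegendreS1 q s n (a * q ^ r)) * q ^ r
        = c⁻¹ * ∑' r : ℕ, (Polynomial.X ^ n * (qE q)^[n] w).eval (a * q ^ r) * q ^ r := by
      intro a ha
      rw [← tsum_mul_left]
      refine tsum_congr fun r => ?_
      rw [hP _ (by positivity), mul_assoc]
    have k1 := k 1 one_ne_zero
    have k2 := k s hs0.ne'
    rw [qInt, qInt0, qInt0]
    rw [k1, k2, qL]
    simp only [one_mul]
    field_simp
  rw [hL, qL_rodrigues q s hq hq1 hs0.ne' n w ?_ ?_ n le_rfl, hw, qBeta q s hq hq1]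
  · have r1 : ∏ i ∈ Finset.range (n + 1), (1 - q ^ (n + 1) * q ^ i)
        = (∏ i ∈ Finset.range n, (1 - q ^ (n + 1 + (i + 1)))) * (1 - q ^ (n + 1)) := by
      rw [Finset.prod_range_succ']
      simp [pow_add]
    have r2 : ∏ i ∈ Finset.range (2 * n + 1), (1 - q ^ (-(n : ℤ)) * s * q ^ i)
        = (∏ i ∈ Finset.range n, (1 - s / q ^ (i + 1))) *
          ∏ i ∈ Finset.range (n + 1), (1 - s * q ^ i) := by
      have : 2 * n + 1 = n + (n + 1) := by ring
      rw [this, Finset.prod_range_add]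
      congr 1
      · rw [← Finset.prod_range_reflect]
        refine Finset.prod_congr rfl fun i hi => ?_
        have hi := Finset.mem_range.mp hi
        obtain ⟨j, rfl⟩ : ∃ j, n = i + 1 + j := ⟨n - 1 - i, by omega⟩
        have e : i + 1 + j - 1 - i = j := by omega
        rw [e, zpow_neg, zpow_natCast, pow_add]
        field_simp
      · refine Finset.prod_congr rfl fun i hi => ?_
        rw [zpow_neg, zpow_natCast, pow_add]
        field_simp
    rw [r1, r2]
    have r3 : q ^ (n ^ 2) = ∏ i ∈ Finset.range n, q ^ n := by
      rw [Finset.prod_const, Finset.card_range, ← pow_mul, sq]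
    rw [r3]
    have r4 : (∏ a ∈ Finset.range n, (-(1 - q ^ (a + 1)) / q ^ (a + 1))) *
        (∏ i ∈ Finset.range n,
          (-(1 - q ^ (i + 1)) * q ^ n * (q ^ (i + 1) - s) / (1 - q ^ (n + 1 + (i + 1)))))
        = (∏ i ∈ Finset.range n, q ^ n) * (∏ i ∈ Finset.range n, (1 - q ^ (i + 1))) ^ 2 *
          (∏ i ∈ Finset.range n, (1 - s / q ^ (i + 1))) /
          (∏ i ∈ Finset.range n, (1 - q ^ (n + 1 + (i + 1)))) := by
      rw [← Finset.prod_pow, ← Finset.prod_mul_distrib, ← Finset.prod_mul_distrib,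
        ← Finset.prod_mul_distrib, ← Finset.prod_div_distrib]
      refine Finset.prod_congr rfl fun i _ => ?_
      have := ne (n + 1 + i)
      have e : n + 1 + (i + 1) = n + 1 + i + 1 := by ring
      rw [e]
      field_simp
    rw [← mul_assoc (∏ a ∈ Finset.range n, (-(1 - q ^ (a + 1)) / q ^ (a + 1))), r4]
    simp only [div_eq_mul_inv, mul_inv]
    ring
  · intro j hj
    rw [hw, Polynomial.eval_mul, qA_eval_self q 1 n j hj, zero_mul]
  · intro j hj
    rw [hw, Polynomial.eval_mul, qA_eval_self q s n j hj, mul_zero]
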